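/- Optimal strong convexity constant of the squared ℓᵖ norm: for 1 < p ≤ 2 and all x, y ∈ ℝᵐ, there exists z* ∈ ℝᵐ (a subgradient of ‖·‖ₚ² at x) such that ‖y‖ₚ² ≥ ‖x‖ₚ² + ⟨z*, y − x⟩ + (p−1)‖y − x‖ₚ². -/

import Mathlib

open Finset

/-- The `ℓᵖ` norm on `ℝᵐ`. -/
noncomputable def lpNorm (p : ℝ) {m : ℕ} (x : Fin m → ℝ) : ℝ :=
  (∑ l, |x l| ^ p) ^ (1 / p)

open Filter Topology

theorem two_mul_le_one_add_rpow_sub_one_sub_rpow {p t : ℝ} (hp1 : 1 < p) (hp2 : p ≤ 2)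
    (ht0 : 0 ≤ t) (ht1 : t ≤ 1) :
    2 * (p - 1) * t ≤ (1 + t) ^ (p - 1) - (1 - t) ^ (p - 1) := by
  have hmono : MonotoneOn
      (fun s : ℝ => (1 + s) ^ (p - 1) - (1 - s) ^ (p - 1) - 2 * (p - 1) * s) (Set.Icc 0 1) := by
    refine monotoneOn_of_hasDerivWithinAt_nonneg (convex_Icc 0 1)
      (f' := fun s => (p - 1) * ((1 + s) ^ (p - 2) + (1 - s) ^ (p - 2) - 2)) ?_ ?_ ?_
    · have h : 0 ≤ p - 1 := by linarith
      refine ContinuousOn.sub (ContinuousOn.sub ?_ ?_) (by fun_prop)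
      · exact ContinuousOn.rpow_const (by fun_prop) fun s _ => Or.inr h
      · exact ContinuousOn.rpow_const (by fun_prop) fun s _ => Or.inr h
    · intro s hs
      rw [interior_Icc] at hs
      obtain ⟨hs0, hs1⟩ := hs
      have h1 := ((hasDerivAt_id s).const_add 1).rpow_const (p := p - 1)
        (Or.inl (by simp; linarith))
      have h2 := ((hasDerivAt_id s).const_sub 1).rpow_const (p := p - 1)
        (Or.inl (by simp; linarith))
      have h3 := (hasDerivAt_id s).const_mul (2 * (p - 1))
      refine (((h1.sub h2).sub h3).congr_deriv ?_).hasDerivWithinAt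
      simp only [id, show p - 1 - 1 = p - 2 by ring]
      ring
    · intro s hs
      rw [interior_Icc] at hs
      obtain ⟨hs0, hs1⟩ := hs
      have ha : 0 < (1 + s) ^ (p - 2) := Real.rpow_pos_of_pos (by linarith) _
      have hb : 0 < (1 - s) ^ (p - 2) := Real.rpow_pos_of_pos (by linarith) _
      have hab : 1 ≤ (1 + s) ^ (p - 2) * (1 - s) ^ (p - 2) := by
        rw [← Real.mul_rpow (by linarith) (by linarith)]
        exact Real.one_le_rpow_of_pos_of_le_one_of_nonpos (by nlinarith) (by nlinarith)
          (by linarith)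
      refine mul_nonneg (by linarith) ?_
      nlinarith [sq_nonneg ((1 + s) ^ (p - 2) - (1 - s) ^ (p - 2))]
  have h := hmono ⟨le_rfl, zero_le_one⟩ ⟨ht0, ht1⟩ ht0
  simp only [add_zero, sub_zero, mul_zero, sub_self] at h
  linarith

theorem two_add_mul_sq_le_one_add_rpow_add_one_sub_rpow {p t : ℝ} (hp1 : 1 < p) (hp2 : p ≤ 2)
    (ht0 : 0 ≤ t) (ht1 : t ≤ 1) :
    2 + p * (p - 1) * t ^ 2 ≤ (1 + t) ^ p + (1 - t) ^ p := by
  have hmono : MonotoneOn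
      (fun s : ℝ => (1 + s) ^ p + (1 - s) ^ p - p * (p - 1) * s ^ 2) (Set.Icc 0 1) := by
    have hp : ∀ s : ℝ, HasDerivAt
        (fun s : ℝ => (1 + s) ^ p + (1 - s) ^ p - p * (p - 1) * s ^ 2)
        (p * ((1 + s) ^ (p - 1) - (1 - s) ^ (p - 1) - 2 * (p - 1) * s)) s := by
      intro s
      have h1 := ((hasDerivAt_id s).const_add 1).rpow_const (p := p) (Or.inr hp1.le)
      have h2 := ((hasDerivAt_id s).const_sub 1).rpow_const (p := p) (Or.inr hp1.le)
      have h3 := ((hasDerivAt_id s).pow 2).const_mul (p * (p - 1))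
      refine ((h1.add h2).sub h3).congr_deriv ?_
      simp only [id]
      ring
    refine monotoneOn_of_hasDerivWithinAt_nonneg (convex_Icc 0 1)
      (fun s _ => (hp s).continuousAt.continuousWithinAt)
      (fun s _ => (hp s).hasDerivWithinAt) fun s hs => ?_
    have hs := interior_subset hs
    have := two_mul_le_one_add_rpow_sub_one_sub_rpow hp1 hp2 hs.1 hs.2
    exact mul_nonneg (by linarith) (by linarith)
  have h := hmono ⟨le_rfl, zero_le_one⟩ ⟨ht0, ht1⟩ ht0
  norm_num at h
  linarith

theorem two_mul_rpow_le_of_abs_le {p a b : ℝ} (hp1 : 1 < p) (hp2 : p ≤ 2)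
    (ha : 0 < a) (hb : 0 ≤ b) (hba : b ≤ a) :
    2 * (a ^ 2 + (p - 1) * b ^ 2) ^ (p / 2) ≤ (a + b) ^ p + (a - b) ^ p := by
  have ht0 : 0 ≤ b / a := by positivity
  have ht1 : b / a ≤ 1 := (div_le_one ha).2 hba
  have hbern : (1 + (p - 1) * (b / a) ^ 2) ^ (p / 2) ≤ 1 + p / 2 * ((p - 1) * (b / a) ^ 2) :=
    rpow_one_add_le_one_add_mul_self
      (by nlinarith [mul_nonneg (sub_nonneg.2 hp1.le) (sq_nonneg (b / a))])
      (by linarith) (by linarith)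
  have hmain := two_add_mul_sq_le_one_add_rpow_add_one_sub_rpow hp1 hp2 ht0 ht1
  have e1 : a ^ 2 + (p - 1) * b ^ 2 = a ^ 2 * (1 + (p - 1) * (b / a) ^ 2) := by
    field_simp
  have e2 : a + b = a * (1 + b / a) := by field_simp
  have e3 : a - b = a * (1 - b / a) := by field_simp
  have e4 : (a ^ 2) ^ (p / 2) = a ^ p := by
    rw [← Real.rpow_natCast, ← Real.rpow_mul ha.le]
    congr 1
    push_cast
    ring
  rw [e1, e2, e3, Real.mul_rpow (by positivity)
    (by nlinarith [mul_nonneg (sub_nonneg.2 hp1.le) (sq_nonneg (b / a))]), e4,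
    Real.mul_rpow ha.le (by linarith), Real.mul_rpow ha.le (by linarith)]
  have : 0 < a ^ p := Real.rpow_pos_of_pos ha p
  nlinarith

/-- The two-point inequality of Ball, Carlen and Lieb. -/
theorem two_mul_rpow_le_abs_add_rpow_add_abs_sub_rpow {p : ℝ} (hp1 : 1 < p) (hp2 : p ≤ 2)
    (a b : ℝ) :
    2 * (a ^ 2 + (p - 1) * b ^ 2) ^ (p / 2) ≤ |a + b| ^ p + |a - b| ^ p := by
  wlog ha : 0 ≤ a generalizing a b
  · have h := this (-a) (-b) (by linarith)
    rwa [neg_sq, neg_sq, show -a + -b = -(a + b) by ring, show -a - -b = -(a - b) by ring,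
      abs_neg, abs_neg] at h
  wlog hb : 0 ≤ b generalizing b
  · have h := this (-b) (by linarith)
    rwa [neg_sq, sub_neg_eq_add, ← sub_eq_add_neg, add_comm (|a - b| ^ p)] at h
  rw [abs_of_nonneg (add_nonneg ha hb)]
  rcases le_total b a with hba | hab
  · rw [abs_of_nonneg (sub_nonneg.2 hba)]
    rcases ha.eq_or_lt with rfl | ha'
    · obtain rfl : b = 0 := le_antisymm hba hb
      simp [Real.zero_rpow (by linarith : p ≠ 0), Real.zero_rpow (by linarith : p / 2 ≠ 0)]
    · exact two_mul_rpow_le_of_abs_le hp1 hp2 ha' hb hba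
  · rw [abs_sub_comm, abs_of_nonneg (sub_nonneg.2 hab)]
    rcases hb.eq_or_lt with rfl | hb'
    · obtain rfl : a = 0 := le_antisymm hab ha
      simp [Real.zero_rpow (by linarith : p ≠ 0), Real.zero_rpow (by linarith : p / 2 ≠ 0)]
    · refine le_trans ?_ ((two_mul_rpow_le_of_abs_le hp1 hp2 hb' ha hab).trans_eq
        (by rw [add_comm b a]))
      have : 0 ≤ (p - 1) * b ^ 2 := mul_nonneg (by linarith) (sq_nonneg b)
      gcongr 2 * ?_
      refine Real.rpow_le_rpow (by positivity) ?_ (by linarith)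
      nlinarith [mul_nonneg (sub_nonneg.2 hp2) (mul_nonneg (sub_nonneg.2 hab) (add_nonneg ha hb))]

/-- The reverse Minkowski inequality for exponents in `(0, 1]`. -/
theorem rpow_sum_rpow_add_rpow_sum_rpow_le {ι : Type*} (s : Finset ι) {r : ℝ} (hr0 : 0 < r)
    (hr1 : r ≤ 1) {u v : ι → ℝ} (hu : ∀ i, 0 ≤ u i) (hv : ∀ i, 0 ≤ v i) :
    (∑ i ∈ s, u i ^ r) ^ (1 / r) + (∑ i ∈ s, v i ^ r) ^ (1 / r) ≤
      (∑ i ∈ s, (u i + v i) ^ r) ^ (1 / r) := by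
  have hu' : 0 ≤ ∑ i ∈ s, u i ^ r := sum_nonneg fun i _ => Real.rpow_nonneg (hu i) r
  have hv' : 0 ≤ ∑ i ∈ s, v i ^ r := sum_nonneg fun i _ => Real.rpow_nonneg (hv i) r
  have hr : 1 / r ≠ 0 := one_div_ne_zero hr0.ne'
  rcases hu'.eq_or_lt with hu0 | hu0
  · rw [← hu0, Real.zero_rpow hr, zero_add]
    refine Real.rpow_le_rpow hv' (sum_le_sum fun i _ => ?_) (by positivity)
    exact Real.rpow_le_rpow (hv i) (by linarith [hu i]) hr0.le
  rcases hv'.eq_or_lt with hv0 | hv0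
  · rw [← hv0, Real.zero_rpow hr, add_zero]
    refine Real.rpow_le_rpow hu' (sum_le_sum fun i _ => ?_) (by positivity)
    exact Real.rpow_le_rpow (hu i) (by linarith [hv i]) hr0.le
  set U := (∑ i ∈ s, u i ^ r) ^ (1 / r) with hU
  set V := (∑ i ∈ s, v i ^ r) ^ (1 / r) with hV
  have hU0 : 0 < U := Real.rpow_pos_of_pos hu0 _
  have hV0 : 0 < V := Real.rpow_pos_of_pos hv0 _
  have hUr : ∑ i ∈ s, u i ^ r = U ^ r := by
    rw [hU, ← Real.rpow_mul hu', one_div_mul_cancel hr0.ne', Real.rpow_one]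
  have hVr : ∑ i ∈ s, v i ^ r = V ^ r := by
    rw [hV, ← Real.rpow_mul hv', one_div_mul_cancel hr0.ne', Real.rpow_one]
  have key : ∀ i, (U + V) ^ r * (U / (U + V) * (u i ^ r / U ^ r) +
      V / (U + V) * (v i ^ r / V ^ r)) ≤ (u i + v i) ^ r := by
    intro i
    have h := (Real.concaveOn_rpow hr0.le hr1).2
      (Set.mem_Ici.2 (div_nonneg (hu i) hU0.le)) (Set.mem_Ici.2 (div_nonneg (hv i) hV0.le))
      (show 0 ≤ U / (U + V) by positivity) (show 0 ≤ V / (U + V) by positivity)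
      (by field_simp)
    simp only [smul_eq_mul] at h
    rw [Real.div_rpow (hu i) hU0.le, Real.div_rpow (hv i) hV0.le,
      show U / (U + V) * (u i / U) + V / (U + V) * (v i / V) = (u i + v i) / (U + V) by
        field_simp,
      Real.div_rpow (add_nonneg (hu i) (hv i)) (by positivity),
      le_div_iff₀ (by positivity)] at h
    linarith
  have hsum : (U + V) ^ r ≤ ∑ i ∈ s, (u i + v i) ^ r := by
    refine le_trans (le_of_eq ?_) (sum_le_sum fun i _ => key i)
    rw [← mul_sum, sum_add_distrib, ← mul_sum, ← mul_sum, ← sum_div, ← sum_div, hUr, hVr]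
    have h1 : 0 < U ^ r := Real.rpow_pos_of_pos hU0 r
    have h2 : 0 < V ^ r := Real.rpow_pos_of_pos hV0 r
    field_simp
  calc U + V = ((U + V) ^ r) ^ (1 / r) := by
        rw [← Real.rpow_mul (by positivity), mul_one_div_cancel hr0.ne', Real.rpow_one]
    _ ≤ _ := Real.rpow_le_rpow (by positivity) hsum (by positivity)

theorem sum_abs_rpow_nonneg (p : ℝ) {m : ℕ} (x : Fin m → ℝ) : 0 ≤ ∑ l, |x l| ^ p :=
  sum_nonneg fun _ _ => Real.rpow_nonneg (abs_nonneg _) p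

theorem lpNorm_sq (p : ℝ) {m : ℕ} (x : Fin m → ℝ) :
    lpNorm p x ^ 2 = (∑ l, |x l| ^ p) ^ (1 / (p / 2)) := by
  rw [lpNorm, ← Real.rpow_natCast, ← Real.rpow_mul (sum_abs_rpow_nonneg p x)]
  congr 1
  push_cast
  rw [one_div_div, one_div_mul_eq_div]

theorem lpNorm_smul_sq {p : ℝ} (hp : 0 < p) {m : ℕ} (c : ℝ) (x : Fin m → ℝ) :
    lpNorm p (c • x) ^ 2 = c ^ 2 * lpNorm p x ^ 2 := by
  have h : lpNorm p (c • x) = |c| * lpNorm p x := by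
    simp only [lpNorm, Pi.smul_apply, smul_eq_mul, abs_mul,
      Real.mul_rpow (abs_nonneg _) (abs_nonneg _), ← mul_sum]
    rw [Real.mul_rpow (by positivity) (sum_abs_rpow_nonneg p x), ← Real.rpow_mul (abs_nonneg c),
      mul_one_div_cancel hp.ne', Real.rpow_one]
  rw [h, mul_pow, sq_abs]

theorem lpNorm_sq_eq_sum_sq {p : ℝ} {m : ℕ} (x : Fin m → ℝ) :
    lpNorm p x ^ 2 = (∑ l, (x l ^ 2) ^ (p / 2)) ^ (1 / (p / 2)) := by
  rw [lpNorm_sq]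
  congr 1
  refine sum_congr rfl fun l _ => ?_
  rw [← sq_abs, ← Real.rpow_natCast, ← Real.rpow_mul (abs_nonneg _)]
  congr 1
  push_cast
  ring

/-- The 2-uniform convexity of `ℓᵖ` for `1 < p ≤ 2`, with optimal constant. -/
theorem two_mul_lpNorm_sq_add_le {p : ℝ} (hp1 : 1 < p) (hp2 : p ≤ 2) {m : ℕ}
    (a b : Fin m → ℝ) :
    2 * (lpNorm p a ^ 2 + (p - 1) * lpNorm p b ^ 2) ≤
      lpNorm p (a + b) ^ 2 + lpNorm p (a - b) ^ 2 := by
  have hc : 1 ≤ 1 / (p / 2) := by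
    rw [one_div_div, le_div_iff₀ (by linarith)]
    linarith
  have hS := sum_abs_rpow_nonneg p (a + b)
  have hT := sum_abs_rpow_nonneg p (a - b)
  have hnn : ∀ l, 0 ≤ (p - 1) * b l ^ 2 := fun l => mul_nonneg (by linarith) (sq_nonneg _)
  have hb : (p - 1) * lpNorm p b ^ 2 =
      (∑ l, ((p - 1) * b l ^ 2) ^ (p / 2)) ^ (1 / (p / 2)) := by
    have h := lpNorm_smul_sq (show 0 < p by linarith) (√(p - 1)) b
    rw [Real.sq_sqrt (by linarith)] at h
    rw [← h, lpNorm_sq_eq_sum_sq]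
    simp only [Pi.smul_apply, smul_eq_mul, mul_pow, Real.sq_sqrt (show 0 ≤ p - 1 by linarith)]
  have hmink := rpow_sum_rpow_add_rpow_sum_rpow_le univ (show 0 < p / 2 by linarith)
    (by linarith) (fun l => sq_nonneg (a l)) hnn
  have htwo : ∑ l, (a l ^ 2 + (p - 1) * b l ^ 2) ^ (p / 2) ≤
      1 / 2 * ∑ l, |(a + b) l| ^ p + 1 / 2 * ∑ l, |(a - b) l| ^ p := by
    rw [mul_sum, mul_sum, ← sum_add_distrib]
    refine sum_le_sum fun l _ => ?_
    have := two_mul_rpow_le_abs_add_rpow_add_abs_sub_rpow hp1 hp2 (a l) (b l)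
    simp only [Pi.add_apply, Pi.sub_apply]
    linarith
  have hpow := Real.rpow_le_rpow
    (sum_nonneg fun l _ => Real.rpow_nonneg (add_nonneg (sq_nonneg _) (hnn l)) _) htwo
    (zero_le_one.trans hc)
  have hconv := (convexOn_rpow hc).2 (Set.mem_Ici.2 hS) (Set.mem_Ici.2 hT)
    (show (0 : ℝ) ≤ 1 / 2 by norm_num) (show (0 : ℝ) ≤ 1 / 2 by norm_num) (by norm_num)
  simp only [smul_eq_mul] at hconv
  rw [lpNorm_sq_eq_sum_sq a, hb, lpNorm_sq p (a + b), lpNorm_sq p (a - b)]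
  linarith

theorem differentiableAt_lpNorm_sq {p : ℝ} (hp1 : 1 < p) {m : ℕ} {x : Fin m → ℝ} (hx : x ≠ 0) :
    DifferentiableAt ℝ (fun w : Fin m → ℝ => lpNorm p w ^ 2) x := by
  have hsum : DifferentiableAt ℝ (fun w : Fin m → ℝ => ∑ l, |w l| ^ p) x := by
    refine DifferentiableAt.fun_sum fun l _ => ?_
    exact (hasDerivAt_abs_rpow (x l) hp1).differentiableAt.comp x
      (f := fun w : Fin m → ℝ => w l) (by fun_prop)
  obtain ⟨l, hl⟩ := Function.ne_iff.1 hx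
  have hpos : 0 < ∑ l, |x l| ^ p :=
    sum_pos' (fun _ _ => Real.rpow_nonneg (abs_nonneg _) p)
      ⟨l, mem_univ l, Real.rpow_pos_of_pos (abs_pos.2 hl) p⟩
  exact (hsum.rpow_const (Or.inl hpos.ne')).pow 2

theorem lpNorm_sq_add_fderiv_add_le {p : ℝ} (hp1 : 1 < p) (hp2 : p ≤ 2) {m : ℕ}
    {x : Fin m → ℝ} (hx : x ≠ 0) (h : Fin m → ℝ) :
    lpNorm p x ^ 2 + fderiv ℝ (fun w : Fin m → ℝ => lpNorm p w ^ 2) x h +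
      (p - 1) * lpNorm p h ^ 2 ≤ lpNorm p (x + h) ^ 2 := by
  set D : ℝ → ℝ := fun t =>
    lpNorm p (x + t • h) ^ 2 - lpNorm p x ^ 2 - (p - 1) * t ^ 2 * lpNorm p h ^ 2 with hD
  have hdouble : ∀ s, 2 * D s ≤ D (2 * s) := by
    intro s
    have hmid := two_mul_lpNorm_sq_add_le hp1 hp2 (x + s • h) (s • h)
    rw [lpNorm_smul_sq (by linarith), add_sub_cancel_right, add_assoc, ← add_smul,
      ← two_mul] at hmid
    simp only [hD]
    nlinarith
  have hpow : ∀ n : ℕ, 2 ^ n * D ((1 / 2) ^ n) ≤ D 1 := by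
    intro n
    induction n with
    | zero => simp
    | succ n ih =>
      refine le_trans ?_ ih
      have := hdouble ((1 / 2) ^ (n + 1))
      rw [show 2 * (1 / 2 : ℝ) ^ (n + 1) = (1 / 2) ^ n by ring] at this
      rw [pow_succ, mul_assoc]
      gcongr
  have hderiv : HasDerivAt D (fderiv ℝ (fun w : Fin m → ℝ => lpNorm p w ^ 2) x h) 0 := by
    have h1 : HasDerivAt (fun t : ℝ => lpNorm p (x + t • h) ^ 2) _ 0 :=
      (differentiableAt_lpNorm_sq hp1 hx).hasFDerivAt.hasLineDerivAt h
    have h2 := (((hasDerivAt_id (0 : ℝ)).pow 2).const_mul (p - 1)).mul_const (lpNorm p h ^ 2)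
    refine ((h1.sub_const (lpNorm p x ^ 2)).sub h2).congr_deriv ?_
    simp
  have hlim : Tendsto (fun n : ℕ => (1 / 2 : ℝ) ^ n) atTop (𝓝[≠] 0) :=
    tendsto_nhdsWithin_iff.2 ⟨tendsto_pow_atTop_nhds_zero_of_lt_one (by norm_num) (by norm_num),
      Eventually.of_forall fun n => by simp⟩
  have hD0 : D 0 = 0 := by simp [hD]
  have hle := le_of_tendsto (hderiv.tendsto_slope_zero.comp hlim)
    (Eventually.of_forall fun n => by
      simpa [hD0] using hpow n : ∀ᶠ _ in _, _ ≤ D 1)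
  simp only [hD, one_smul, one_pow, mul_one] at hle
  linarith

theorem exists_lpNorm_sq_add_sum_add_le {p : ℝ} (hp1 : 1 < p) (hp2 : p ≤ 2) {m : ℕ}
    (x : Fin m → ℝ) :
    ∃ z : Fin m → ℝ, ∀ w : Fin m → ℝ,
      lpNorm p x ^ 2 + (∑ l, z l * (w l - x l)) + (p - 1) * lpNorm p (w - x) ^ 2 ≤
        lpNorm p w ^ 2 := by
  rcases eq_or_ne x 0 with rfl | hx
  · refine ⟨0, fun w => ?_⟩
    have h0 : lpNorm p (0 : Fin m → ℝ) ^ 2 = 0 := by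
      simpa using lpNorm_smul_sq (show 0 < p by linarith) 0 (0 : Fin m → ℝ)
    simp only [h0, Pi.zero_apply, zero_mul, sum_const_zero, sub_zero, add_zero, zero_add]
    nlinarith [sq_nonneg (lpNorm p w)]
  · set L := fderiv ℝ (fun w : Fin m → ℝ => lpNorm p w ^ 2) x with hL
    refine ⟨fun l => L (Pi.single l 1), fun w => ?_⟩
    have h := lpNorm_sq_add_fderiv_add_le hp1 hp2 hx (w - x)
    rw [add_sub_cancel, ← hL] at h
    have hsum : ∑ l, L (Pi.single l 1) * (w l - x l) = L (w - x) := by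
      rw [← ContinuousLinearMap.coe_coe, LinearMap.pi_apply_eq_sum_univ]
      refine sum_congr rfl fun l _ => ?_
      rw [smul_eq_mul, mul_comm]
      congr 2
      ext j
      simp [Pi.single_apply, eq_comm]
    rwa [hsum]

/-- Strong convexity of the squared `ℓᵖ` norm with constant `2(p−1)`: for
`1 < p ≤ 2` and all `x, y ∈ ℝᵐ` there is a subgradient `z*` of `‖·‖ₚ²` at `x`
with `‖y‖ₚ² ≥ ‖x‖ₚ² + ⟨z*, y − x⟩ + (p−1)‖y − x‖ₚ²`. -/
theorem stmt_11 (p : ℝ) (hp1 : 1 < p) (hp2 : p ≤ 2) (m : ℕ) (x y : Fin m → ℝ) :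
    ∃ z : Fin m → ℝ,
      (∀ w : Fin m → ℝ,
        lpNorm p w ^ 2 ≥ lpNorm p x ^ 2 + ∑ l, z l * (w l - x l)) ∧
      lpNorm p y ^ 2 ≥
        lpNorm p x ^ 2 + (∑ l, z l * (y l - x l)) + (p - 1) * lpNorm p (y - x) ^ 2 := by
  obtain ⟨z, hz⟩ := exists_lpNorm_sq_add_sum_add_le hp1 hp2 x
  refine ⟨z, fun w => ?_, hz y⟩
  have hnn : 0 ≤ (p - 1) * lpNorm p (w - x) ^ 2 := mul_nonneg (by linarith) (sq_nonneg _)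
  linarith [hz w]
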